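/- (Dynamic Programming Principle.) Let Ω ⊆ ℝⁿ be open and let L : closure(Ω) × ℝⁿ → ℝ be continuous with L(x,0) ≤ C₁ and L(x,v) ≥ −C₂ for all (x,v), for some constants C₁, C₂ > 0. For x in the closure of Ω, let A_x be the set of absolutely continuous curves η : [0,∞) → ℝⁿ with η(0) = x and η(s) in the closure of Ω for all s ≥ 0, and define the value function u(x) = inf_{η ∈ A_x} ∫₀^∞ e^{−s} L(η(s), −η̇(s)) ds. Then for every x in the closure of Ω and every t > 0, u(x) = inf_{η ∈ A_x} { ∫₀ᵗ e^{−s} L(η(s), −η̇(s)) ds + e^{−t} u(η(t)) }. -/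

import Mathlib

open Metric Set MeasureTheory Filter
open scoped Topology NNReal RealInnerProductSpace

noncomputable section

abbrev Euc (n : ℕ) := EuclideanSpace ℝ (Fin n)

/-- `v` is a viscosity subsolution of `v + H(x, Dv) = 0` in the open set `Ω`. -/
def IsViscositySubsolutionIn {n : ℕ} (Ω : Set (Euc n)) (H : Euc n → Euc n → ℝ)
    (v : Euc n → ℝ) : Prop :=
  ∀ x ∈ Ω, ∀ φ : Euc n → ℝ, ContDiff ℝ 1 φ →
    IsLocalMaxOn (fun y => v y - φ y) Ω x → v x + H x (gradient φ x) ≤ 0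

/-- `v` is a viscosity supersolution of `v + H(x, Dv) = 0` on the closure of `Ω`. -/
def IsViscositySupersolutionOn {n : ℕ} (Ω : Set (Euc n)) (H : Euc n → Euc n → ℝ)
    (v : Euc n → ℝ) : Prop :=
  ∀ x ∈ closure Ω, ∀ φ : Euc n → ℝ, ContDiff ℝ 1 φ →
    IsLocalMinOn (fun y => v y - φ y) (closure Ω) x → 0 ≤ v x + H x (gradient φ x)

/-- `v` is a state-constraint viscosity solution on `Ω`. -/
def IsStateConstraintSolution {n : ℕ} (Ω : Set (Euc n)) (H : Euc n → Euc n → ℝ)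
    (v : Euc n → ℝ) : Prop :=
  ContinuousOn v (closure Ω) ∧ IsViscositySubsolutionIn Ω H v ∧
    IsViscositySupersolutionOn Ω H v

/-- Admissible curve/velocity pairs: `p.1` is the curve, `p.2` its (locally integrable)
velocity; the curve starts at `x`, stays in the closure of `Ω`, and has integrable cost. -/
def Curves {n : ℕ} (Ω : Set (Euc n)) (L : Euc n → Euc n → ℝ) (x : Euc n) :
    Set ((ℝ → Euc n) × (ℝ → Euc n)) :=
  {p | (∀ t : ℝ, 0 ≤ t → IntegrableOn p.2 (Icc 0 t) volume) ∧
    (∀ t : ℝ, 0 ≤ t → p.1 t = x + ∫ s in Icc (0:ℝ) t, p.2 s) ∧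
    (∀ t : ℝ, 0 ≤ t → p.1 t ∈ closure Ω) ∧
    IntegrableOn (fun s => Real.exp (-s) * L (p.1 s) (-p.2 s)) (Ioi (0:ℝ)) volume}

/-- The cost functional `J[x, η] = ∫₀^∞ e^{-s} L(η(s), -η̇(s)) ds`. -/
def costJ {n : ℕ} (L : Euc n → Euc n → ℝ) (p : (ℝ → Euc n) × (ℝ → Euc n)) : ℝ :=
  ∫ s in Ioi (0:ℝ), Real.exp (-s) * L (p.1 s) (-p.2 s)

/-- The value function `u(x) = inf_{η ∈ A_x} J[x, η]`. -/
def valueFun {n : ℕ} (Ω : Set (Euc n)) (L : Euc n → Euc n → ℝ) (x : Euc n) : ℝ :=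
  sInf (costJ L '' Curves Ω L x)

lemma shift_integrableOn {E : Type*} [NormedAddCommGroup E] (f : ℝ → E) (t : ℝ) (S : Set ℝ) :
    IntegrableOn (fun s => f (s + t)) ((fun s => s + t) ⁻¹' S) volume ↔ IntegrableOn f S volume :=
  (measurePreserving_add_right volume t).integrableOn_comp_preimage
    (measurableEmbedding_addRight t)

lemma shift_integral {E : Type*} [NormedAddCommGroup E] [NormedSpace ℝ E]
    (f : ℝ → E) (t : ℝ) (S : Set ℝ) :
    ∫ s in (fun s => s + t) ⁻¹' S, f (s + t) = ∫ s in S, f s :=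
  (measurePreserving_add_right volume t).setIntegral_preimage_emb
    (measurableEmbedding_addRight t) f S

lemma Curves_nonempty {n : ℕ} (Ω : Set (Euc n)) (L : Euc n → Euc n → ℝ) (x : Euc n)
    (hx : x ∈ closure Ω) : (Curves Ω L x).Nonempty := by
  refine ⟨(fun _ => x, fun _ => 0), ?_, ?_, ?_, ?_⟩
  · intro t _; simp
  · intro t _; simp
  · intro t _; exact hx
  · exact Integrable.mul_const (integrableOn_exp_neg_Ioi 0) (L x (-0))

lemma costJ_bdd {n : ℕ} (Ω : Set (Euc n)) (L : Euc n → Euc n → ℝ) (C₂ : ℝ)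
    (hL2 : ∀ x ∈ closure Ω, ∀ v : Euc n, -C₂ ≤ L x v) (x : Euc n)
    (p : (ℝ → Euc n) × (ℝ → Euc n)) (hp : p ∈ Curves Ω L x) : -C₂ ≤ costJ L p := by
  obtain ⟨_, _, h3, h4⟩ := hp
  have h : ∫ s in Ioi (0:ℝ), Real.exp (-s) * (-C₂) = -C₂ := by
    rw [integral_mul_const, integral_exp_neg_Ioi_zero, one_mul]
  rw [← h]
  refine setIntegral_mono_on ((integrableOn_exp_neg_Ioi 0).mul_const _) h4 measurableSet_Ioi ?_
  intro s hs
  exact mul_le_mul_of_nonneg_left (hL2 _ (h3 s (le_of_lt hs)) _) (Real.exp_pos _).le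

lemma valueFun_le {n : ℕ} (Ω : Set (Euc n)) (L : Euc n → Euc n → ℝ) (C₂ : ℝ)
    (hL2 : ∀ x ∈ closure Ω, ∀ v : Euc n, -C₂ ≤ L x v) (x : Euc n)
    (p : (ℝ → Euc n) × (ℝ → Euc n)) (hp : p ∈ Curves Ω L x) : valueFun Ω L x ≤ costJ L p := by
  refine csInf_le ⟨-C₂, ?_⟩ ⟨p, hp, rfl⟩
  rintro _ ⟨q, hq, rfl⟩
  exact costJ_bdd Ω L C₂ hL2 x q hq

lemma cost_split {n : ℕ} (L : Euc n → Euc n → ℝ) (p q : (ℝ → Euc n) × (ℝ → Euc n))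
    (t : ℝ) (ht : 0 < t)
    (hint : IntegrableOn (fun s => Real.exp (-s) * L (p.1 s) (-p.2 s)) (Ioi (0:ℝ)) volume)
    (h1 : ∀ s, 0 < s → q.1 s = p.1 (s + t)) (h2 : ∀ s, 0 < s → q.2 s = p.2 (s + t)) :
    costJ L p = (∫ s in Ioc (0:ℝ) t, Real.exp (-s) * L (p.1 s) (-p.2 s)) +
      Real.exp (-t) * costJ L q := by
  unfold costJ
  rw [← Ioc_union_Ioi_eq_Ioi ht.le, setIntegral_union (Ioc_disjoint_Ioi le_rfl) measurableSet_Ioi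
    (hint.mono_set Ioc_subset_Ioi_self) (hint.mono_set (Ioi_subset_Ioi ht.le)),
    Ioc_union_Ioi_eq_Ioi ht.le, ← shift_integral _ t (Ioi t), ← integral_const_mul]
  congr 1
  have : (fun s : ℝ => s + t) ⁻¹' Ioi t = Ioi 0 := by simp
  rw [this]
  refine setIntegral_congr_fun measurableSet_Ioi fun s hs => ?_
  simp only [h1 s hs, h2 s hs]
  rw [← mul_assoc, ← Real.exp_add]
  congr 2
  ring

lemma shift_mem {n : ℕ} (Ω : Set (Euc n)) (L : Euc n → Euc n → ℝ) (x : Euc n)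
    (p : (ℝ → Euc n) × (ℝ → Euc n)) (hp : p ∈ Curves Ω L x) (t : ℝ) (ht : 0 < t) :
    ((fun s => p.1 (s + t), fun s => p.2 (s + t)) : (ℝ → Euc n) × (ℝ → Euc n)) ∈
      Curves Ω L (p.1 t) := by
  obtain ⟨h1, h2, h3, h4⟩ := hp
  refine ⟨?_, ?_, ?_, ?_⟩
  · intro b hb
    have := (shift_integrableOn p.2 t (Icc t (b + t))).2
      ((h1 (b + t) (by linarith)).mono_set (Icc_subset_Icc_left ht.le))
    simpa using this
  · intro b hb
    have e : (fun s : ℝ => s + t) ⁻¹' Ioc t (b + t) = Ioc 0 b := by simp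
    have hI := h1 (b + t) (by linarith)
    simp only
    rw [h2 (b + t) (by linarith), h2 t ht.le, integral_Icc_eq_integral_Ioc,
      integral_Icc_eq_integral_Ioc, integral_Icc_eq_integral_Ioc, ← e, shift_integral,
      ← Ioc_union_Ioc_eq_Ioc ht.le (by linarith : t ≤ b + t),
      setIntegral_union (Ioc_disjoint_Ioc_of_le le_rfl) measurableSet_Ioc
        (hI.mono_set fun s hs => ⟨hs.1.le, by linarith [hs.2]⟩)
        (hI.mono_set fun s hs => ⟨by linarith [hs.1], hs.2⟩), add_assoc]
  · intro b hb
    exact h3 _ (by linarith)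
  · have := (shift_integrableOn _ t (Ioi t)).2 (h4.mono_set (Ioi_subset_Ioi ht.le))
    have e : (fun s : ℝ => s + t) ⁻¹' Ioi t = Ioi 0 := by simp
    rw [e] at this
    have := this.const_mul (Real.exp t)
    refine IntegrableOn.congr_fun this (fun s _ => ?_) measurableSet_Ioi
    simp only
    rw [← mul_assoc, ← Real.exp_add]
    congr 2
    ring

/-- Concatenation of two functions at time `t`. -/
def glue {E : Type*} (t : ℝ) (f g : ℝ → E) : ℝ → E := fun s => if s ≤ t then f s else g (s - t)

lemma glue_le {E : Type*} (t : ℝ) (f g : ℝ → E) (s : ℝ) (h : s ≤ t) : glue t f g s = f s := by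
  simp [glue, h]

lemma glue_gt {E : Type*} (t : ℝ) (f g : ℝ → E) (s : ℝ) (h : t < s) :
    glue t f g s = g (s - t) := by
  simp [glue, h]

lemma glue_mem {n : ℕ} (Ω : Set (Euc n)) (L : Euc n → Euc n → ℝ) (x : Euc n)
    (p q : (ℝ → Euc n) × (ℝ → Euc n)) (t : ℝ) (ht : 0 < t) (hp : p ∈ Curves Ω L x)
    (hq : q ∈ Curves Ω L (p.1 t)) :
    ((glue t p.1 q.1, glue t p.2 q.2) : (ℝ → Euc n) × (ℝ → Euc n)) ∈ Curves Ω L x := by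
  obtain ⟨h1, h2, h3, h4⟩ := hp
  obtain ⟨k1, k2, k3, k4⟩ := hq
  have hA : IntegrableOn (glue t p.2 q.2) (Ioc 0 t) volume :=
    ((h1 t ht.le).mono_set Ioc_subset_Icc_self).congr_fun
      (fun s hs => (glue_le t _ _ s hs.2).symm) measurableSet_Ioc
  have e : ∀ b, (fun s : ℝ => s + t) ⁻¹' Ioc t (b + t) = Ioc 0 b := by intro b; simp
  have hB : ∀ b, 0 ≤ b → IntegrableOn (glue t p.2 q.2) (Ioc t (b + t)) volume := by
    intro b hb
    rw [← shift_integrableOn _ t, e]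
    refine ((k1 b hb).mono_set Ioc_subset_Icc_self).congr_fun (fun s hs => ?_) measurableSet_Ioc
    rw [glue_gt _ _ _ _ (by linarith [hs.1])]
    simp
  refine ⟨?_, ?_, ?_, ?_⟩
  · intro T hT
    rw [integrableOn_Icc_iff_integrableOn_Ioc]
    refine (hA.union (hB T hT)).mono_set ?_
    rw [Ioc_union_Ioc_eq_Ioc ht.le (by linarith)]
    exact Ioc_subset_Ioc_right (by linarith)
  · intro T hT
    simp only
    rw [integral_Icc_eq_integral_Ioc]
    rcases le_or_gt T t with h | h
    · rw [glue_le _ _ _ _ h, h2 T hT, integral_Icc_eq_integral_Ioc]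
      congr 1
      exact setIntegral_congr_fun measurableSet_Ioc
        fun s hs => (glue_le t _ _ s (hs.2.trans h)).symm
    · obtain ⟨b, rfl⟩ : ∃ b, T = b + t := ⟨T - t, by ring⟩
      have hb : 0 ≤ b := by linarith
      rw [glue_gt _ _ _ _ h, add_sub_cancel_right, k2 b hb, h2 t ht.le,
        ← Ioc_union_Ioc_eq_Ioc ht.le h.le,
        setIntegral_union (Ioc_disjoint_Ioc_of_le le_rfl) measurableSet_Ioc hA (hB b hb), add_assoc,
        integral_Icc_eq_integral_Ioc, integral_Icc_eq_integral_Ioc]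
      congr 2
      · exact setIntegral_congr_fun measurableSet_Ioc
          fun s hs => (glue_le t _ _ s hs.2).symm
      · rw [← shift_integral (glue t p.2 q.2) t, e]
        refine setIntegral_congr_fun measurableSet_Ioc fun s hs => ?_
        rw [glue_gt _ _ _ _ (by linarith [hs.1])]
        simp
  · intro T hT
    simp only
    rcases le_or_gt T t with h | h
    · rw [glue_le _ _ _ _ h]; exact h3 T hT
    · rw [glue_gt _ _ _ _ h]; exact k3 _ (by linarith)
  · rw [← Ioc_union_Ioi_eq_Ioi ht.le]
    refine IntegrableOn.union ?_ ?_
    · refine (h4.mono_set Ioc_subset_Ioi_self).congr_fun (fun s hs => ?_) measurableSet_Ioc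
      simp only
      rw [glue_le _ _ _ _ hs.2, glue_le _ _ _ _ hs.2]
    · rw [← shift_integrableOn _ t]
      have e' : (fun s : ℝ => s + t) ⁻¹' Ioi t = Ioi 0 := by simp
      rw [e']
      refine IntegrableOn.congr_fun (k4.const_mul (Real.exp (-t))) (fun s hs => ?_)
        measurableSet_Ioi
      have hs' : t < s + t := by linarith [mem_Ioi.1 hs]
      simp only
      rw [glue_gt _ _ _ _ hs', glue_gt _ _ _ _ hs', add_sub_cancel_right, ← mul_assoc,
        ← Real.exp_add]
      congr 2
      ring

/-- Theorem 5.2 (Dynamic Programming Principle). -/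
theorem dynamic_programming_principle {n : ℕ} (Ω : Set (Euc n)) (hΩ : IsOpen Ω)
    (L : Euc n → Euc n → ℝ)
    (hLcont : ContinuousOn (Function.uncurry L) (closure Ω ×ˢ (univ : Set (Euc n))))
    (C₁ C₂ : ℝ) (hC₁ : 0 < C₁) (hC₂ : 0 < C₂)
    (hL1 : ∀ x ∈ closure Ω, L x 0 ≤ C₁)
    (hL2 : ∀ x ∈ closure Ω, ∀ v : Euc n, -C₂ ≤ L x v) :
    ∀ x ∈ closure Ω, ∀ t : ℝ, 0 < t →
      valueFun Ω L x =
        sInf ((fun p => (∫ s in Ioc (0:ℝ) t, Real.exp (-s) * L (p.1 s) (-p.2 s)) +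
          Real.exp (-t) * valueFun Ω L (p.1 t)) '' Curves Ω L x) := by
  intro x hx t ht
  have key : ∀ p ∈ Curves Ω L x, valueFun Ω L x ≤
      (∫ s in Ioc (0:ℝ) t, Real.exp (-s) * L (p.1 s) (-p.2 s)) +
          Real.exp (-t) * valueFun Ω L (p.1 t) := by
    intro p hp
    have hne := (Curves_nonempty Ω L (p.1 t) (hp.2.2.1 t ht.le)).image (costJ L)
    have hle : (valueFun Ω L x - ∫ s in Ioc (0:ℝ) t, Real.exp (-s) * L (p.1 s) (-p.2 s)) /
        Real.exp (-t) ≤ valueFun Ω L (p.1 t) := by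
      refine le_csInf hne ?_
      rintro _ ⟨q, hq, rfl⟩
      rw [div_le_iff₀ (Real.exp_pos _)]
      have hr := glue_mem Ω L x p q t ht hp hq
      have h := valueFun_le Ω L C₂ hL2 x _ hr
      rw [cost_split L _ q t ht hr.2.2.2
        (fun s hs => by simp only; rw [glue_gt _ _ _ _ (by linarith)]; simp)
        (fun s hs => by simp only; rw [glue_gt _ _ _ _ (by linarith)]; simp)] at h
      have h' : ∫ s in Ioc (0:ℝ) t, Real.exp (-s) *
          L (glue t p.1 q.1 s) (-glue t p.2 q.2 s) =
          ∫ s in Ioc (0:ℝ) t, Real.exp (-s) * L (p.1 s) (-p.2 s) := by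
        refine setIntegral_congr_fun measurableSet_Ioc fun s hs => ?_
        rw [glue_le _ _ _ _ hs.2, glue_le _ _ _ _ hs.2]
      rw [h'] at h
      linarith
    rw [div_le_iff₀ (Real.exp_pos _)] at hle
    linarith
  have hne := Curves_nonempty Ω L x hx
  apply le_antisymm
  · refine le_csInf (hne.image _) ?_
    rintro _ ⟨p, hp, rfl⟩
    exact key p hp
  · refine le_csInf (hne.image _) ?_
    rintro _ ⟨p, hp, rfl⟩
    refine (csInf_le ⟨valueFun Ω L x, ?_⟩ (mem_image_of_mem _ hp)).trans ?_
    · rintro _ ⟨q, hq, rfl⟩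
      exact key q hq
    · have hs := shift_mem Ω L x p hp t ht
      rw [cost_split L p (fun s => p.1 (s + t), fun s => p.2 (s + t)) t ht hp.2.2.2
        (fun _ _ => rfl) (fun _ _ => rfl)]
      have := mul_le_mul_of_nonneg_left (valueFun_le Ω L C₂ hL2 _ _ hs) (Real.exp_pos (-t)).le
      linarith
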